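/- arXiv:2604.05768 — 2 statements merged into one kernel-verified Lean document; each statement's English description precedes it below -/
import Mathlib

section
/- Furstenberg correspondence principle: Let Γ be a countable abelian group, Φ a Følner sequence for Γ, and E ⊆ Γ. Then there exist a Γ-system (X, ℬ, μ, T) and a measurable set A ⊆ X such that (i) μ(A) = d_Φ(E), and (ii) for every k ≥ 1 and all γ_0, γ_1, …, γ_k ∈ Γ one has d_Φ(⋂_{i=0}^{k}(E − γ_i)) ≥ μ(⋂_{i=0}^{k} T^{−γ_i} A). -/
open MeasureTheory Filter Topology
open scoped symmDiff Classical

noncomputable section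

/-- A Følner sequence in an abelian group: a sequence of nonempty finite subsets that is
asymptotically invariant under translations. -/
def IsFolner {Γ : Type*} [AddCommGroup Γ] (Φ : ℕ → Finset Γ) : Prop :=
  (∀ N, (Φ N).Nonempty) ∧
    ∀ a : Γ,
      Tendsto (fun N => ((((Φ N).image (· + a)) ∆ (Φ N)).card : ℝ) / ((Φ N).card : ℝ))
        atTop (nhds 0)

/-- Upper density of a set `E ⊆ Γ` along a Følner sequence `Φ`. -/
def upperDensity {Γ : Type*} [AddCommGroup Γ] (Φ : ℕ → Finset Γ) (E : Set Γ) : ℝ :=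
  Filter.limsup
    (fun N => (((Φ N).filter (fun x => x ∈ E)).card : ℝ) / ((Φ N).card : ℝ)) atTop

/-- A `Γ`-system: a compact metric space with its Borel σ-algebra, a (automatically regular)
Borel probability measure, and a measure-preserving action of `Γ`. -/
structure GSystem (Γ : Type*) [AddCommGroup Γ] where
  X : Type
  met : MetricSpace X
  cpt : CompactSpace X
  mble : MeasurableSpace X
  borelSpace : BorelSpace X
  μ : Measure X
  prob : IsProbabilityMeasure μ
  T : Γ → X → X
  T_zero : T 0 = id
  T_add : ∀ γ γ' : Γ, T (γ + γ') = T γ ∘ T γ'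
  measurePreserving : ∀ γ : Γ, MeasurePreserving (T γ) μ μ

attribute [instance] GSystem.met GSystem.cpt GSystem.mble GSystem.borelSpace GSystem.prob

/-- The set `E ∩ (E - γ) ∩ ⋯ ∩ (E - (k-1)γ)`. -/
def progPreimage {Γ : Type*} [AddCommGroup Γ] (E : Set Γ) (k : ℕ) (γ : Γ) : Set Γ :=
  ⋂ i ∈ Finset.range k, (fun x => x + i • γ) ⁻¹' E

/-- The set `A ∩ T^{-γ}A ∩ ⋯ ∩ T^{-(k-1)γ}A`. -/
def recIntersection {Γ : Type*} [AddCommGroup Γ] (S : GSystem Γ) (A : Set S.X) (k : ℕ)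
    (γ : Γ) : Set S.X :=
  ⋂ i ∈ Finset.range k, S.T (i • γ) ⁻¹' A

/-- The Furstenberg constant `c(k, δ, Γ)`. -/
def cF (Γ : Type*) [AddCommGroup Γ] (k : ℕ) (δ : ℝ) : ℝ :=
  sInf {r : ℝ | ∃ Φ : ℕ → Finset Γ, IsFolner Φ ∧ ∃ E : Set Γ, δ ≤ upperDensity Φ E ∧
    r = sSup {s : ℝ | ∃ γ : Γ, γ ≠ 0 ∧ s = upperDensity Φ (progPreimage E k γ)}}

/-- The Furstenberg–Katznelson constant `c_IP(k, δ, Γ)`. -/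
def cIP (Γ : Type*) [AddCommGroup Γ] (k : ℕ) (δ : ℝ) : ℝ :=
  sInf {r : ℝ | ∃ Φ : ℕ → Finset Γ, IsFolner Φ ∧ ∃ E : Set Γ, δ ≤ upperDensity Φ E ∧
    ∃ γseq : ℕ → Γ,
      r = sSup {s : ℝ | ∃ F : Finset ℕ, F.Nonempty ∧
        s = upperDensity Φ (progPreimage E k (∑ n ∈ F, γseq n))}}

/-- The recurrence constant `c^rec(k, δ, Γ)`. -/
def cRec (Γ : Type*) [AddCommGroup Γ] (k : ℕ) (δ : ℝ) : ℝ :=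
  sInf {r : ℝ | ∃ (S : GSystem Γ) (A : Set S.X), MeasurableSet A ∧ δ ≤ (S.μ A).toReal ∧
    r = sSup {s : ℝ | ∃ γ : Γ, γ ≠ 0 ∧ s = (S.μ (recIntersection S A k γ)).toReal}}

/-- The IP recurrence constant `c_IP^rec(k, δ, Γ)`. -/
def cIPRec (Γ : Type*) [AddCommGroup Γ] (k : ℕ) (δ : ℝ) : ℝ :=
  sInf {r : ℝ | ∃ (S : GSystem Γ) (A : Set S.X), MeasurableSet A ∧ δ ≤ (S.μ A).toReal ∧
    ∃ γseq : ℕ → Γ,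
      r = sSup {s : ℝ | ∃ F : Finset ℕ, F.Nonempty ∧
        s = (S.μ (recIntersection S A k (∑ n ∈ F, γseq n))).toReal}}

/-- `F_p^ω`, the countable direct sum of copies of `ZMod p`. -/
abbrev Fpω (p : ℕ) : Type := ℕ →₀ ZMod p


/-- The proportion of a finite set `s` lying in `B`. -/
def relDensity {Γ : Type*} (s : Finset Γ) (B : Set Γ) : ℝ :=
  ((s.filter (fun x => x ∈ B)).card : ℝ) / (s.card : ℝ)

lemma relDensity_nonneg {Γ : Type*} (s : Finset Γ) (B : Set Γ) : 0 ≤ relDensity s B := by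
  unfold relDensity
  positivity

lemma relDensity_le_one {Γ : Type*} (s : Finset Γ) (B : Set Γ) : relDensity s B ≤ 1 :=
  div_le_one_of_le₀ (by exact_mod_cast Finset.card_filter_le _ _) (by positivity)

lemma abs_relDensity_preimage_add_sub_le {Γ : Type*} [AddCommGroup Γ] (s : Finset Γ) (B : Set Γ)
    (a : Γ) :
    |relDensity s ((· + a) ⁻¹' B) - relDensity s B| ≤
      (((s.image (· + a)) ∆ s).card : ℝ) / (s.card : ℝ) := by
  have hshift : (s.filter (fun x => x ∈ (· + a) ⁻¹' B)).card =
      ((s.image (· + a)).filter (fun x => x ∈ B)).card := by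
    rw [Finset.filter_image, Finset.card_image_of_injective _ (add_left_injective a)]
    rfl
  have key : ∀ t u : Finset Γ, (t.filter (fun x => x ∈ B)).card ≤
      (u.filter (fun x => x ∈ B)).card + (t ∆ u).card := by
    intro t u
    refine (Finset.card_le_card ?_).trans (Finset.card_union_le _ _)
    intro x hx
    simp only [Finset.mem_filter, Finset.mem_union, Finset.mem_symmDiff] at hx ⊢
    tauto
  have h₁ := key (s.image (· + a)) s
  have h₂ := key s (s.image (· + a))
  rw [symmDiff_comm] at h₂
  unfold relDensity
  rw [hshift, ← sub_div, abs_div, abs_of_nonneg (Nat.cast_nonneg (α := ℝ) s.card)]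
  gcongr
  rw [abs_le]
  have h₁' : (_ : ℝ) ≤ _ := Nat.cast_le.mpr h₁
  have h₂' : (_ : ℝ) ≤ _ := Nat.cast_le.mpr h₂
  push_cast at h₁' h₂'
  constructor <;> linarith

lemma IsFolner.tendsto_relDensity_preimage_add_sub {Γ : Type*} [AddCommGroup Γ]
    {Φ : ℕ → Finset Γ} (hΦ : IsFolner Φ) (B : Set Γ) (a : Γ) :
    Tendsto (fun N => relDensity (Φ N) ((· + a) ⁻¹' B) - relDensity (Φ N) B) atTop (𝓝 0) :=
  squeeze_zero_norm (fun N => abs_relDensity_preimage_add_sub_le (Φ N) B a) (hΦ.2 a)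

lemma le_limsup_of_tendsto_of_le {f g : Filter ℕ} [g.NeBot] (hgf : g ≤ f) {u : ℕ → ℝ}
    (hu : f.IsBoundedUnder (· ≤ ·) u) {l : ℝ} (h : Tendsto u g (𝓝 l)) : l ≤ limsup u f := by
  refine le_of_forall_lt fun c hc => ?_
  obtain ⟨d, hcd, hdl⟩ := exists_between hc
  exact hcd.trans_le (le_limsup_of_frequently_le
    (((h.eventually_const_lt hdl).frequently.filter_mono hgf).mono fun _ => le_of_lt) hu)

lemma exists_ultrafilter_tendsto_limsup {f : Filter ℕ} [f.NeBot] {u : ℕ → ℝ}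
    (hu : f.IsBoundedUnder (· ≤ ·) u) (hu' : f.IsBoundedUnder (· ≥ ·) u) :
    ∃ U : Ultrafilter ℕ, ↑U ≤ f ∧ Tendsto u U (𝓝 (limsup u f)) := by
  rw [← mapClusterPt_iff_ultrafilter,
    (nhds_basis_Ioo (limsup u f)).mapClusterPt_iff_frequently]
  rintro ⟨a, b⟩ ⟨ha, hb⟩
  exact (frequently_lt_of_lt_limsup hu'.isCoboundedUnder_le ha).and_eventually
    (eventually_lt_of_limsup_lt hb hu)

lemma exists_probabilityMeasure_tendsto_relDensity {Γ X : Type*} [MetricSpace X] [CompactSpace X]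
    [MeasurableSpace X] [BorelSpace X] {Φ : ℕ → Finset Γ} (hΦ : ∀ N, (Φ N).Nonempty)
    (U : Ultrafilter ℕ) (f : Γ → X) :
    ∃ μ : ProbabilityMeasure X, ∀ B : Set X, IsClopen B →
      Tendsto (fun N => relDensity (Φ N) (f ⁻¹' B)) U (𝓝 ((μ : Measure X) B).toReal) := by
  let ν : ℕ → ProbabilityMeasure X := fun N =>
    ⟨((PMF.uniformOfFinset (Φ N) (hΦ N)).map f).toMeasure, inferInstance⟩
  obtain ⟨μ, -, hμ⟩ := isCompact_univ.ultrafilter_le_nhds (U.map ν) (by simp)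
  refine ⟨μ, fun B hB => ?_⟩
  have h := ProbabilityMeasure.tendsto_measure_of_null_frontier_of_tendsto' (L := (U : Filter ℕ))
    (μs := ν) hμ (by simp [hB.frontier_eq] : (μ : Measure X) (frontier B) = 0)
  refine ((ENNReal.tendsto_toReal (measure_ne_top _ _)).comp h).congr fun N => ?_
  simp only [Function.comp_apply, ν, ProbabilityMeasure.coe_mk]
  rw [PMF.toMeasure_apply_eq_toOuterMeasure_apply _ hB.isOpen.measurableSet, PMF.toOuterMeasure_map_apply,
    PMF.toOuterMeasure_uniformOfFinset_apply]
  simp [relDensity, ENNReal.toReal_div]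

lemma measure_ext_of_isClopen {X : Type*} [TopologicalSpace X] [T2Space X] [CompactSpace X]
    [TotallyDisconnectedSpace X] [SecondCountableTopology X] [MeasurableSpace X] [BorelSpace X]
    {μ ν : Measure X} [IsFiniteMeasure μ] (h : ∀ B, IsClopen B → μ B = ν B) : μ = ν := by
  refine ext_of_generate_finite {B | IsClopen B} ?_ (fun s hs t ht _ => hs.inter ht) h
    (h _ isClopen_univ)
  rw [BorelSpace.measurable_eq (α := X), isTopologicalBasis_isClopen.borel_eq_generateFrom]

/-- **The Furstenberg correspondence principle.** For every countable abelian group `Γ`,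
every Følner sequence `Φ` and every `E ⊆ Γ`, there are a `Γ`-system and a measurable set
`A` with `μ(A) = d_Φ(E)` and such that for every `k ≥ 1` and all `γ_0, …, γ_k ∈ Γ`,
`d_Φ(⋂_{i≤k} (E - γ_i)) ≥ μ(⋂_{i≤k} T^{-γ_i} A)`. -/
theorem furstenberg_correspondence_principle
    (Γ : Type) [AddCommGroup Γ] [Countable Γ]
    (Φ : ℕ → Finset Γ) (hΦ : IsFolner Φ) (E : Set Γ) :
    ∃ (S : GSystem Γ) (A : Set S.X), MeasurableSet A ∧
      (S.μ A).toReal = upperDensity Φ E ∧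
      ∀ k : ℕ, 1 ≤ k → ∀ γ : Fin (k + 1) → Γ,
        upperDensity Φ (⋂ i : Fin (k + 1), (fun x => x + γ i) ⁻¹' E) ≥
          (S.μ (⋂ i : Fin (k + 1), S.T (γ i) ⁻¹' A)).toReal := by
  have bdd (B : Set Γ) : atTop.IsBoundedUnder (· ≤ ·) (fun N => relDensity (Φ N) B) :=
    isBoundedUnder_of ⟨1, fun N => relDensity_le_one _ _⟩
  obtain ⟨U, hU, hUE⟩ := exists_ultrafilter_tendsto_limsup (bdd E)
    (isBoundedUnder_of ⟨0, fun N => relDensity_nonneg _ _⟩)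
  let _ : MetricSpace (Γ → Bool) := TopologicalSpace.metrizableSpaceMetric _
  let T : Γ → (Γ → Bool) → (Γ → Bool) := fun γ x h => x (h + γ)
  have hT (γ : Γ) : Continuous (T γ) := continuous_pi fun h => continuous_apply (h + γ)
  let orbit : Γ → (Γ → Bool) := fun g => T g fun h => decide (h ∈ E)
  have orbit_preimage (γ : Γ) (B : Set (Γ → Bool)) :
      orbit ⁻¹' (T γ ⁻¹' B) = (· + γ) ⁻¹' (orbit ⁻¹' B) := by
    ext g
    simp only [Set.mem_preimage, orbit, T]
    simp only [add_assoc, add_comm γ g]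
  obtain ⟨μ, hμ⟩ := exists_probabilityMeasure_tendsto_relDensity hΦ.1 U orbit
  have hμT (γ : Γ) : MeasurePreserving (T γ) (μ : Measure (Γ → Bool)) μ := by
    refine ⟨(hT γ).measurable, ?_⟩
    have := Measure.isProbabilityMeasure_map (μ := (μ : Measure (Γ → Bool)))
      (hT γ).measurable.aemeasurable
    refine measure_ext_of_isClopen fun B hB => ?_
    rw [Measure.map_apply (hT γ).measurable hB.isOpen.measurableSet,
      ← ENNReal.toReal_eq_toReal_iff' (measure_ne_top _ _) (measure_ne_top _ _), ← sub_eq_zero]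
    refine tendsto_nhds_unique ((hμ _ (hB.preimage (hT γ))).sub (hμ B hB)) ?_
    rw [orbit_preimage]
    exact (hΦ.tendsto_relDensity_preimage_add_sub _ γ).mono_left hU
  let A : Set (Γ → Bool) := (fun x => x 0) ⁻¹' {true}
  have hA : IsClopen A := (isClopen_discrete {true}).preimage (continuous_apply 0)
  have orbit_A : orbit ⁻¹' A = E := by
    ext g
    simp [orbit, A, T]
  refine ⟨{ X := Γ → Bool, met := inferInstance, cpt := inferInstance, mble := inferInstance
            borelSpace := inferInstance, μ := μ, prob := inferInstance, T := T
            T_zero := ?_, T_add := ?_, measurePreserving := hμT }, A, hA.isOpen.measurableSet, ?_, ?_⟩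
  · ext x h
    simp [T]
  · intro γ γ'
    ext x h
    simp [T, add_assoc]
  · refine tendsto_nhds_unique (hμ A hA) ?_
    rwa [orbit_A]
  · intro k _ γ
    refine le_limsup_of_tendsto_of_le hU (bdd _) ?_
    have h := hμ (⋂ i, T (γ i) ⁻¹' A) (isClopen_iInter_of_finite fun i => hA.preimage (hT (γ i)))
    simpa only [Set.preimage_iInter, orbit_preimage, orbit_A] using h

end
end

section
/- Strong upper bound for the Furstenberg–Katznelson IP Roth constant over finite fields: for every prime p > 2 there are arbitrarily small δ ∈ (0,1] satisfying c_IP(3,δ,F_p^ω) ≤ δ^{1+log₂ p} + δ^{2·log₂ p}; that is, for every δ_0 > 0 there exists δ ∈ (0,δ_0] for which this inequality holds. -/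
open MeasureTheory Filter Topology
open scoped symmDiff Classical

noncomputable section

section UpperDensity

theorem relativeDensity_le_one {Γ : Type*} (Φ : ℕ → Finset Γ) (E : Set Γ) (N : ℕ) :
    (((Φ N).filter (fun x => x ∈ E)).card : ℝ) / ((Φ N).card : ℝ) ≤ 1 :=
  div_le_one_of_le₀ (by exact_mod_cast Finset.card_filter_le _ _) (by positivity)

variable {Γ Γ' : Type*} [AddCommGroup Γ] [AddCommGroup Γ']

theorem upperDensity_nonneg (Φ : ℕ → Finset Γ) (E : Set Γ) : 0 ≤ upperDensity Φ E := by
  refine le_limsup_of_frequently_le (Frequently.of_forall fun N => by positivity) ?_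
  exact isBoundedUnder_of ⟨1, relativeDensity_le_one Φ E⟩

theorem upperDensity_le_of_eventually {Φ : ℕ → Finset Γ} {E : Set Γ} {c : ℝ}
    (h : ∀ᶠ N in atTop,
      (((Φ N).filter (fun x => x ∈ E)).card : ℝ) / ((Φ N).card : ℝ) ≤ c) :
    upperDensity Φ E ≤ c := by
  refine limsup_le_of_le ?_ h
  exact isCoboundedUnder_le_of_le atTop (x := 0) fun N => by positivity

theorem cIP_le {k : ℕ} {δ c : ℝ} (hc : 0 ≤ c) (Φ : ℕ → Finset Γ) (hΦ : IsFolner Φ) (E : Set Γ)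
    (hE : δ ≤ upperDensity Φ E) (γseq : ℕ → Γ)
    (h : ∀ F : Finset ℕ, F.Nonempty →
      upperDensity Φ (progPreimage E k (∑ n ∈ F, γseq n)) ≤ c) :
    cIP Γ k δ ≤ c := by
  unfold cIP
  refine le_trans (csInf_le ?_ ⟨Φ, hΦ, E, hE, γseq, rfl⟩) (Real.sSup_le ?_ hc)
  · refine ⟨0, ?_⟩
    rintro r ⟨Φ, -, E, -, γseq, rfl⟩
    refine Real.sSup_nonneg ?_
    rintro s ⟨F, -, rfl⟩
    exact upperDensity_nonneg _ _
  · rintro s ⟨F, hF, rfl⟩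
    exact h F hF

theorem IsFolner.map_addEquiv (e : Γ ≃+ Γ') {Φ : ℕ → Finset Γ} (hΦ : IsFolner Φ) :
    IsFolner fun N => (Φ N).map e.toEquiv.toEmbedding := by
  refine ⟨fun N => (hΦ.1 N).map, fun a => ?_⟩
  convert hΦ.2 (e.symm a) using 3 with N
  · norm_cast
    rw [← Finset.card_map e.toEquiv.toEmbedding]
    congr 1
    ext x
    obtain ⟨x, rfl⟩ := e.surjective x
    simp [Finset.mem_symmDiff]
  · simp

theorem upperDensity_map_addEquiv (e : Γ ≃+ Γ') (Φ : ℕ → Finset Γ) (E : Set Γ) :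
    upperDensity (fun N => (Φ N).map e.toEquiv.toEmbedding) (e.symm ⁻¹' E) =
      upperDensity Φ E := by
  unfold upperDensity
  congr 1
  ext N
  simp [Finset.filter_map]

theorem progPreimage_symm_preimage (e : Γ ≃+ Γ') (E : Set Γ) (k : ℕ) (γ : Γ) :
    progPreimage (e.symm ⁻¹' E) k (e γ) = e.symm ⁻¹' progPreimage E k γ := by
  ext x
  simp [progPreimage]

theorem cIP_congr (e : Γ ≃+ Γ') (k : ℕ) (δ : ℝ) : cIP Γ k δ = cIP Γ' k δ := by
  unfold cIP
  congr 1
  ext r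
  constructor
  · rintro ⟨Φ, hΦ, E, hE, γseq, rfl⟩
    refine ⟨_, hΦ.map_addEquiv e, e.symm ⁻¹' E, ?_, fun n => e (γseq n), ?_⟩
    · rwa [upperDensity_map_addEquiv]
    · simp_rw [← map_sum, progPreimage_symm_preimage, upperDensity_map_addEquiv]
  · rintro ⟨Φ, hΦ, E, hE, γseq, rfl⟩
    refine ⟨_, hΦ.map_addEquiv e.symm, e.symm.symm ⁻¹' E, ?_, fun n => e.symm (γseq n), ?_⟩
    · rwa [upperDensity_map_addEquiv]
    · simp_rw [← map_sum, progPreimage_symm_preimage, upperDensity_map_addEquiv]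

end UpperDensity

section SkewProduct

variable {V K : Type*} [AddCommGroup V]

section Cocycle

variable [AddCommGroup K]

/-- The sum of the values of `f` along a finitely supported sequence. -/
def cocycle (f : V → K) (x : ℕ →₀ V) : K := x.sum fun _ v => f v

theorem cocycle_eq_sum {f : V → K} (h0 : f 0 = 0) (x : ℕ →₀ V) {s : Finset ℕ}
    (hs : x.support ⊆ s) : cocycle f x = ∑ i ∈ s, f (x i) :=
  Finsupp.sum_of_support_subset _ hs _ fun _ _ => h0

theorem cocycle_add_sum_single {f : V → K} (h0 : f 0 = 0) {t : V} {m : ℕ}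
    (ht : ∀ v, f (v + t) = m • f v) (F : Finset ℕ) (x : ℕ →₀ V) :
    cocycle f (x + ∑ n ∈ F, Finsupp.single n t) + ∑ i ∈ F, f (x i) =
      cocycle f x + m • ∑ i ∈ F, f (x i) := by
  have hval : ∀ i, (x + ∑ n ∈ F, Finsupp.single n t) i = if i ∈ F then x i + t else x i := by
    intro i
    by_cases hi : i ∈ F <;> simp [Finsupp.single_apply, hi]
  have hs : (x + ∑ n ∈ F, Finsupp.single n t).support ⊆ x.support ∪ F := by
    intro i hi
    rw [Finsupp.mem_support_iff, hval] at hi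
    by_contra hc
    simp only [Finset.mem_union, Finsupp.mem_support_iff, not_or, not_not] at hc
    simp [hc.1, hc.2] at hi
  rw [cocycle_eq_sum h0 _ hs, cocycle_eq_sum h0 x Finset.subset_union_left,
    ← Finset.sum_sdiff (Finset.subset_union_right (s₁ := x.support) (s₂ := F)),
    ← Finset.sum_sdiff (Finset.subset_union_right (s₁ := x.support) (s₂ := F))
      (f := fun i => f (x i)),
    Finset.smul_sum]
  have h1 : ∑ i ∈ F, f ((x + ∑ n ∈ F, Finsupp.single n t) i) = ∑ i ∈ F, m • f (x i) :=
    Finset.sum_congr rfl fun i hi => by rw [hval, if_pos hi, ht]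
  have h2 : ∑ i ∈ (x.support ∪ F) \ F, f ((x + ∑ n ∈ F, Finsupp.single n t) i) =
      ∑ i ∈ (x.support ∪ F) \ F, f (x i) :=
    Finset.sum_congr rfl fun i hi => by rw [hval, if_neg (Finset.mem_sdiff.1 hi).2]
  rw [h1, h2]
  abel

end Cocycle

variable [Fintype V]

/-- The finitely supported sequences that vanish from `N` on. -/
def initialBox (V : Type*) [AddCommGroup V] [Fintype V] (N : ℕ) : Finset (ℕ →₀ V) :=
  (Finset.range N).finsupp fun _ => Finset.univ

theorem mem_initialBox {N : ℕ} {x : ℕ →₀ V} :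
    x ∈ initialBox V N ↔ x.support ⊆ Finset.range N := by
  simp [initialBox, Finset.mem_finsupp_iff]

theorem card_initialBox (N : ℕ) : (initialBox V N).card = Fintype.card V ^ N := by
  simp [initialBox, Finset.card_finsupp]

theorem apply_eq_zero_of_mem_initialBox {N : ℕ} {x : ℕ →₀ V} (hx : x ∈ initialBox V N) :
    x N = 0 := by
  by_contra h
  simpa using mem_initialBox.1 hx (Finsupp.mem_support_iff.2 h)

section Fibre

variable [AddCommGroup K]

theorem card_filter_sum_eq_zero_le {f : V → K} {M : ℕ}
    (hM : ∀ k, (Finset.univ.filter fun v => f v = k).card ≤ M) {F : Finset ℕ} (hF : F.Nonempty)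
    {N : ℕ} (hFN : F ⊆ Finset.range N) :
    ((initialBox V N).filter fun x => ∑ i ∈ F, f (x i) = 0).card * Fintype.card V ≤
      M * Fintype.card V ^ N := by
  obtain ⟨j, hj⟩ := hF
  have hjN := hFN hj
  have himage : (((initialBox V N).filter fun x => ∑ i ∈ F, f (x i) = 0).image
      fun x => x.erase j) ⊆ ((Finset.range N).erase j).finsupp fun _ => (Finset.univ : Finset V) := by
    intro y hy
    simp only [Finset.mem_image, Finset.mem_filter, mem_initialBox] at hy
    obtain ⟨x, ⟨hx, -⟩, rfl⟩ := hy
    simp only [Finset.mem_finsupp_iff, Finsupp.support_erase, Finset.mem_univ, implies_true,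
      and_true]
    exact Finset.erase_subset_erase _ hx
  have hfibre : ∀ y ∈ (((initialBox V N).filter fun x => ∑ i ∈ F, f (x i) = 0).image
      fun x => x.erase j),
      (((initialBox V N).filter fun x => ∑ i ∈ F, f (x i) = 0).filter
        fun x => x.erase j = y).card ≤ M := by
    intro y _
    refine le_trans ?_ (hM (-∑ i ∈ F.erase j, f (y i)))
    refine Finset.card_le_card_of_injOn (fun x => x j) ?_ ?_
    · intro x hx
      simp only [Finset.coe_filter, Finset.mem_filter, Set.mem_ofPred_eq] at hx
      obtain ⟨⟨-, hx⟩, rfl⟩ := hx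
      simp only [Finset.coe_filter, Finset.mem_univ, true_and, Set.mem_ofPred_eq]
      rw [eq_neg_iff_add_eq_zero, ← hx, ← Finset.add_sum_erase F _ hj]
      congr 1
      exact Finset.sum_congr rfl fun i hi => by
        rw [Finsupp.erase_ne (Finset.ne_of_mem_erase hi)]
    · intro x hx x' hx' h
      simp only [Finset.coe_filter, Finset.mem_filter, Set.mem_ofPred_eq] at hx hx'
      rw [← Finsupp.single_add_erase j x, ← Finsupp.single_add_erase j x', hx.2, hx'.2]
      simp only at h
      rw [h]
  have hcard := Finset.card_le_mul_card_image _ M hfibre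
  have hle := Finset.card_le_card himage
  rw [Finset.card_finsupp, Finset.prod_const, Finset.card_univ, Finset.card_erase_of_mem hjN,
    Finset.card_range] at hle
  have hN : N ≠ 0 := by
    rintro rfl
    simp at hjN
  calc _ ≤ M * Fintype.card V ^ (N - 1) * Fintype.card V :=
        Nat.mul_le_mul_right _ (hcard.trans (Nat.mul_le_mul_left _ hle))
    _ = _ := by rw [mul_assoc, pow_sub_one_mul hN]

theorem cocycle_add_single {f : V → K} (h0 : f 0 = 0) {N : ℕ} {x : ℕ →₀ V}
    (hx : x ∈ initialBox V N) (v : V) :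
    cocycle f (x + Finsupp.single N v) = cocycle f x + f v := by
  rw [mem_initialBox] at hx
  rw [cocycle_eq_sum h0 (s := Finset.range (N + 1)), cocycle_eq_sum h0 x hx,
    Finset.sum_range_succ]
  · congr 1
    · refine Finset.sum_congr rfl fun i hi => ?_
      rw [Finset.mem_range] at hi
      simp [Finsupp.single_eq_of_ne hi.ne]
    · rw [← mem_initialBox] at hx
      simp [apply_eq_zero_of_mem_initialBox hx]
  · refine Finsupp.support_add.trans (Finset.union_subset (hx.trans ?_)
      (Finsupp.support_single_subset.trans ?_))
    · simp
    · simp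

end Fibre

variable [Fintype K]

/-- The sequences supported on `{0, …, N}` whose last entry lies in the range of `σ`. -/
def sectionBox (σ : K → V) (N : ℕ) : Finset (ℕ →₀ V) :=
  (initialBox V N ×ˢ (Finset.univ : Finset K)).image fun y => y.1 + Finsupp.single N (σ y.2)

theorem sectionBox_injOn {σ : K → V} (hσ : Function.Injective σ) (N : ℕ) :
    Set.InjOn (fun y : (ℕ →₀ V) × K => y.1 + Finsupp.single N (σ y.2))
      (initialBox V N ×ˢ (Finset.univ : Finset K) : Finset _) := by
  rintro ⟨x, k⟩ hx ⟨x', k'⟩ hx' h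
  simp only [Finset.coe_product, Set.mem_prod, Finset.mem_coe] at hx hx'
  simp only at h
  have hk : k = k' := by
    have := DFunLike.congr_fun h N
    simp only [Finsupp.add_apply, apply_eq_zero_of_mem_initialBox hx.1,
      apply_eq_zero_of_mem_initialBox hx'.1, Finsupp.single_eq_same, zero_add] at this
    exact hσ this
  subst hk
  simpa using h

theorem card_sectionBox {σ : K → V} (hσ : Function.Injective σ) (N : ℕ) :
    (sectionBox σ N).card = Fintype.card V ^ N * Fintype.card K := by
  rw [sectionBox, Finset.card_image_of_injOn (sectionBox_injOn hσ N), Finset.card_product,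
    card_initialBox, Finset.card_univ]

variable [AddCommGroup K]

theorem isFolner_sectionBox (σ : K → V) : IsFolner (sectionBox σ) := by
  refine ⟨fun N => ?_, fun a => ?_⟩
  · refine Finset.Nonempty.image ⟨(0, 0), ?_⟩ _
    simp [mem_initialBox]
  · refine tendsto_const_nhds.congr' ?_
    obtain ⟨M, hM⟩ := a.support.exists_nat_subset_range
    filter_upwards [eventually_ge_atTop M] with N hN
    have h : (sectionBox σ N).image (· + a) = sectionBox σ N := by
      refine Finset.eq_of_subset_of_card_le ?_ ?_
      · intro z hz
        simp only [sectionBox, Finset.mem_image, Finset.mem_product, Finset.mem_univ, and_true,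
          Prod.exists] at hz ⊢
        obtain ⟨_, ⟨x, k, hx, rfl⟩, rfl⟩ := hz
        refine ⟨x + a, k, ?_, by abel⟩
        rw [mem_initialBox] at hx ⊢
        exact Finsupp.support_add.trans
          (Finset.union_subset hx (hM.trans (Finset.range_subset_range.2 hN)))
      · rw [Finset.card_image_of_injective _ (add_left_injective a)]
    have h' : (((sectionBox σ N).image (· + a)) ∆ sectionBox σ N).card = 0 := by
      rw [Finset.card_eq_zero, Finset.symmDiff_eq_empty]
      convert h
    have h'' : ((((sectionBox σ N).image (· + a)) ∆ sectionBox σ N).card : ℝ) = 0 := by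
      exact_mod_cast h'
    convert (zero_div _).symm using 2
    convert h''

theorem card_filter_sectionBox {f : V → K} (h0 : f 0 = 0) {σ : K → V}
    (hσ : Function.RightInverse σ f) (B : Finset K) {N : ℕ} (P : (ℕ →₀ V) → Prop)
    (hP : ∀ x v, P (x + Finsupp.single N v) ↔ P x) :
    ((sectionBox σ N).filter fun x => cocycle f x ∈ B ∧ P x).card =
      ((initialBox V N).filter P).card * B.card := by
  rw [sectionBox, Finset.filter_image,
    Finset.card_image_of_injOn ((sectionBox_injOn hσ.injective N).mono
      (Finset.coe_subset.2 (Finset.filter_subset _ _))),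
    Finset.card_filter, Finset.sum_product, Finset.card_filter, Finset.sum_mul]
  refine Finset.sum_congr rfl fun x hx => ?_
  simp only [hP, cocycle_add_single h0 hx, hσ _]
  by_cases h : P x
  · simp only [h, and_true, if_true, one_mul]
    rw [← Finset.card_filter]
    refine Finset.card_bij (fun k _ => cocycle f x + k) (by simp) (by simp) fun b hb =>
      ⟨b - cocycle f x, by simpa using hb, by abel⟩
  · simp [h]

theorem cIP_le_of_cocycle {f : V → K} (h0 : f 0 = 0) (hf : Function.Surjective f) {t : V}
    (ht : ∀ v, f (v + t) = 2 • f v) {M : ℕ}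
    (hM : ∀ k, (Finset.univ.filter fun v => f v = k).card ≤ M) (B : Finset K)
    (hB : ∀ a w, a ∈ B → a + w ∈ B → a + 3 • w ∈ B → w = 0) :
    cIP (ℕ →₀ V) 3 (B.card / Fintype.card K) ≤
      (B.card / Fintype.card K : ℝ) * (M / Fintype.card V) := by
  have hV : (0 : ℝ) < Fintype.card V := by exact_mod_cast Fintype.card_pos
  have hK : (0 : ℝ) < Fintype.card K := by exact_mod_cast Fintype.card_pos
  set σ := Function.surjInv hf
  have hσ : Function.RightInverse σ f := Function.rightInverse_surjInv hf
  refine cIP_le (by positivity) (sectionBox σ) (isFolner_sectionBox σ)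
    {x | cocycle f x ∈ B} ?_ (fun n => Finsupp.single n t) fun F hF => ?_
  · refine le_limsup_of_frequently_le (Frequently.of_forall fun N => ?_)
      (isBoundedUnder_of ⟨1, relativeDensity_le_one _ _⟩)
    have := card_filter_sectionBox h0 hσ B (N := N) (fun _ => True) (by simp)
    simp only [and_true, Finset.filter_true, card_initialBox] at this
    simp only [Set.mem_ofPred_eq]
    rw [this, card_sectionBox hσ.injective]
    push_cast
    rw [mul_div_mul_left _ _ (by positivity)]
  · refine upperDensity_le_of_eventually ?_
    obtain ⟨N₀, hN₀⟩ := F.exists_nat_subset_range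
    filter_upwards [eventually_ge_atTop N₀] with N hN
    have hFN : F ⊆ Finset.range N := hN₀.trans (Finset.range_subset_range.2 hN)
    have hsub : ((sectionBox σ N).filter fun x =>
        x ∈ progPreimage {x | cocycle f x ∈ B} 3 (∑ n ∈ F, Finsupp.single n t)) ⊆
        (sectionBox σ N).filter fun x => cocycle f x ∈ B ∧ ∑ i ∈ F, f (x i) = 0 := by
      refine Finset.monotone_filter_right _ fun x _ hx => ?_
      have hmem : ∀ i < 3, cocycle f (x + i • ∑ n ∈ F, Finsupp.single n t) ∈ B := by
        simpa [progPreimage] using hx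
      have hx0 : cocycle f x ∈ B := by simpa using hmem 0 (by norm_num)
      refine ⟨hx0, hB _ _ hx0 ?_ ?_⟩
      · have h1 := cocycle_add_sum_single h0 ht F x
        rw [two_smul, ← add_assoc, add_right_cancel_iff] at h1
        simpa [h1] using hmem 1 (by norm_num)
      · have ht4 : ∀ v, f (v + 2 • t) = 4 • f v := fun v => by
          rw [two_smul, ← add_assoc, ht, ht, smul_smul]
          rfl
        have h2 := cocycle_add_sum_single h0 ht4 F x
        rw [show 4 • ∑ i ∈ F, f (x i) = 3 • ∑ i ∈ F, f (x i) + ∑ i ∈ F, f (x i) from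
          succ_nsmul _ 3, ← add_assoc, add_right_cancel_iff] at h2
        rw [← h2]
        simpa [Finset.smul_sum] using hmem 2 (by norm_num)
    have hcount := card_filter_sectionBox h0 hσ B (N := N) (fun x => ∑ i ∈ F, f (x i) = 0) (by
      intro x v
      have : ∑ i ∈ F, f ((x + Finsupp.single N v) i) = ∑ i ∈ F, f (x i) := by
        refine Finset.sum_congr rfl fun i hi => ?_
        rw [Finsupp.add_apply, Finsupp.single_eq_of_ne (Finset.mem_range.1 (hFN hi)).ne, add_zero]
      rw [this])
    have hle := (Finset.card_le_card hsub).trans hcount.le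
    have hzero := card_filter_sum_eq_zero_le hM hF hFN
    rw [card_sectionBox hσ.injective]
    set Z := ((initialBox V N).filter fun x => ∑ i ∈ F, f (x i) = 0).card
    have hle' : ((((sectionBox σ N).filter fun x =>
        x ∈ progPreimage {x | cocycle f x ∈ B} 3 (∑ n ∈ F, Finsupp.single n t)).card : ℕ) : ℝ) ≤
        Z * B.card := by exact_mod_cast hle
    have hzero' : (Z : ℝ) * Fintype.card V ≤ M * (Fintype.card V : ℝ) ^ N := by
      exact_mod_cast hzero
    push_cast
    rw [div_mul_div_comm, div_le_div_iff₀ (by positivity) (by positivity)]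
    calc _ ≤ (Z * B.card : ℝ) * (Fintype.card K * Fintype.card V) := by gcongr
      _ = (B.card * Fintype.card K : ℝ) * (Z * Fintype.card V) := by ring
      _ ≤ (B.card * Fintype.card K : ℝ) * (M * (Fintype.card V : ℝ) ^ N) := by gcongr
      _ = _ := by ring

end SkewProduct

section SolutionFree

variable {n q D : ℕ} [NeZero q]

theorem eq_of_add_two_mul_eq_three_mul {x y z : ZMod q} (hD : 3 * D ≤ q + 2)
    (hx : x.val < D) (hy : y.val < D) (hz : z.val < D) (h : z + 2 * x = 3 * y) :
    z.val + 2 * x.val = 3 * y.val := by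
  have hcast : ((z.val + 2 * x.val : ℕ) : ZMod q) = (3 * y.val : ℕ) := by
    push_cast
    simpa using h
  rw [ZMod.natCast_eq_natCast_iff'] at hcast
  rwa [Nat.mod_eq_of_lt (by omega), Nat.mod_eq_of_lt (by omega)] at hcast

theorem eq_zero_of_sphere {r : ℕ} (hD : 3 * D ≤ q + 2) {a w : Fin n → ZMod q}
    (ha : ∀ i, (a i).val < D) (ha' : ∑ i, (a i).val ^ 2 = r)
    (hb : ∀ i, ((a + w) i).val < D) (hb' : ∑ i, ((a + w) i).val ^ 2 = r)
    (hc : ∀ i, ((a + 3 • w) i).val < D) (hc' : ∑ i, ((a + 3 • w) i).val ^ 2 = r) : w = 0 := by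
  have hlin : ∀ i, ((a + 3 • w) i).val + 2 * (a i).val = 3 * ((a + w) i).val := fun i =>
    eq_of_add_two_mul_eq_three_mul hD (ha i) (hb i) (hc i) (by simp; ring)
  have hsum : ∑ i, 6 * (((a i).val : ℤ) - ((a + w) i).val) ^ 2 = 0 := by
    have key : ∀ i, 6 * (((a i).val : ℤ) - ((a + w) i).val) ^ 2 =
        (((a + 3 • w) i).val : ℤ) ^ 2 + 2 * ((a i).val : ℤ) ^ 2 -
          3 * (((a + w) i).val : ℤ) ^ 2 := by
      intro i
      have h : (((a + 3 • w) i).val : ℤ) = 3 * ((a + w) i).val - 2 * (a i).val := by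
        have := hlin i
        omega
      rw [h]
      ring
    simp_rw [key, Finset.sum_sub_distrib, Finset.sum_add_distrib, ← Finset.mul_sum]
    have e1 : ∑ i, ((a i).val : ℤ) ^ 2 = r := by exact_mod_cast ha'
    have e2 : ∑ i, (((a + w) i).val : ℤ) ^ 2 = r := by exact_mod_cast hb'
    have e3 : ∑ i, (((a + 3 • w) i).val : ℤ) ^ 2 = r := by exact_mod_cast hc'
    rw [e1, e2, e3]
    ring
  funext i
  have hi := (Finset.sum_eq_zero_iff_of_nonneg fun j _ => by positivity).1 hsum i
    (Finset.mem_univ i)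
  have hval : (a i).val = ((a + w) i).val := by
    have : ((a i).val : ℤ) - ((a + w) i).val = 0 := by simpa using hi
    omega
  simpa using ZMod.val_injective q hval

theorem exists_solutionFree (n : ℕ) (hD : 3 * D ≤ q + 2) (hDq : D ≤ q) :
    ∃ B : Finset (Fin n → ZMod q),
      (∀ a w, a ∈ B → a + w ∈ B → a + 3 • w ∈ B → w = 0) ∧
      (D : ℝ) ^ n / (n * q ^ 2 + 1 : ℕ) ≤ B.card ∧ B.card ≤ D ^ n := by
  set digits : Finset (ZMod q) := Finset.univ.filter fun x => x.val < D with hdigits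
  have hcard : digits.card = D := by
    rw [← Finset.card_range D]
    symm
    refine Finset.card_bij (fun m _ => (m : ZMod q)) ?_ ?_ ?_
    · intro m hm
      rw [Finset.mem_range] at hm
      simpa [hdigits, ZMod.val_natCast, Nat.mod_eq_of_lt (hm.trans_le hDq)] using hm
    · intro m hm m' hm' h
      rw [Finset.mem_range] at hm hm'
      rwa [ZMod.natCast_eq_natCast_iff', Nat.mod_eq_of_lt (hm.trans_le hDq),
        Nat.mod_eq_of_lt (hm'.trans_le hDq)] at h
    · intro x hx
      exact ⟨x.val, by simpa [hdigits] using hx, by simp⟩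
  set A : Finset (Fin n → ZMod q) := Fintype.piFinset fun _ => digits with hA
  have hAcard : A.card = D ^ n := by simp [hA, hcard]
  have hmaps : ∀ x ∈ A, ∑ i, (x i).val ^ 2 ∈ Finset.range (n * q ^ 2 + 1) := by
    intro x _
    rw [Finset.mem_range, Nat.lt_succ_iff]
    calc ∑ i, (x i).val ^ 2 ≤ ∑ _i : Fin n, q ^ 2 :=
          Finset.sum_le_sum fun i _ => Nat.pow_le_pow_left (ZMod.val_lt _).le 2
      _ = n * q ^ 2 := by simp
  obtain ⟨r, -, hr⟩ := Finset.exists_le_card_fiber_of_nsmul_le_card_of_maps_to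
    (b := (D : ℝ) ^ n / (n * q ^ 2 + 1 : ℕ)) hmaps Finset.nonempty_range_add_one (by
      rw [Finset.card_range, nsmul_eq_mul, mul_div_cancel₀ _ (by positivity), hAcard]
      simp)
  refine ⟨_, ?_, hr, (Finset.card_filter_le _ _).trans hAcard.le⟩
  intro a w ha hb hc
  simp only [Finset.mem_filter, hA, Fintype.mem_piFinset, hdigits, Finset.mem_univ,
    true_and] at ha hb hc
  exact eq_zero_of_sphere hD ha.1 ha.2 hb.1 hb.2 hc.1 hc.2

end SolutionFree

theorem exists_balanced_map (U K : Type*) [Zero U] [Fintype U] [AddCommGroup K] [Fintype K]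
    (h : Fintype.card K ≤ Fintype.card U) :
    ∃ c : U → K, c 0 = 0 ∧ Function.Surjective c ∧
      ∀ k, (Finset.univ.filter fun u => c u = k).card * Fintype.card K ≤ 2 * Fintype.card U := by
  have hK : 0 < Fintype.card K := Fintype.card_pos
  set eU := Fintype.equivFin U
  set eK := Fintype.equivFin K
  set d : U → K := fun u => eK.symm ⟨(eU u : ℕ) % Fintype.card K, Nat.mod_lt _ hK⟩ with hd
  refine ⟨fun u => d u - d 0, sub_self _, fun k => ?_, fun k => ?_⟩
  · set j := eK (k + d 0) with hj
    refine ⟨eU.symm ⟨j, j.2.trans_le h⟩, ?_⟩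
    have : d (eU.symm ⟨j, j.2.trans_le h⟩) = k + d 0 := by
      simp only [hd, Equiv.apply_symm_apply, Nat.mod_eq_of_lt j.2]
      simp [hj]
      rfl
    simp only [this]
    abel
  · have hle : (Finset.univ.filter fun u => d u - d 0 = k).card ≤
        (Finset.range (Fintype.card U / Fintype.card K + 1)).card := by
      refine Finset.card_le_card_of_injOn (fun u => (eU u : ℕ) / Fintype.card K) ?_ ?_
      · intro u _
        simp only [Finset.coe_range, Set.mem_Iio, Nat.lt_succ_iff]
        exact Nat.div_le_div_right (eU u).2.le
      · intro u hu v hv huv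
        simp only [Finset.coe_filter, Finset.mem_univ, true_and, Set.mem_ofPred_eq] at hu hv
        have hmod : d u = d v := sub_left_injective (hu.trans hv.symm)
        simp only [hd, EmbeddingLike.apply_eq_iff_eq, Fin.mk.injEq] at hmod huv
        refine eU.injective (Fin.ext ?_)
        rw [← Nat.div_add_mod (eU u : ℕ) (Fintype.card K), hmod, huv, Nat.div_add_mod]
    rw [Finset.card_range] at hle
    calc _ ≤ (Fintype.card U / Fintype.card K + 1) * Fintype.card K := Nat.mul_le_mul_right _ hle
      _ = Fintype.card U / Fintype.card K * Fintype.card K + Fintype.card K := by ring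
      _ ≤ Fintype.card U + Fintype.card U := add_le_add (Nat.div_mul_le_self _ _) h
      _ = _ := by ring

theorem nonempty_addEquiv_finsupp (p : ℕ) [Fact p.Prime] (U : Type) [AddCommGroup U]
    [Module (ZMod p) U] [Module.Finite (ZMod p) U] :
    Nonempty (Fpω p ≃+ (ℕ →₀ ZMod p × U)) := by
  obtain ⟨e⟩ : Nonempty (Fpω p ≃ₗ[ZMod p] (ℕ →₀ ZMod p × U)) := by
    refine nonempty_linearEquiv_of_rank_eq ?_
    rw [rank_finsupp_self', rank_finsupp', Cardinal.mk_nat, eq_comm]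
    refine Cardinal.mul_eq_left le_rfl (Module.rank_lt_aleph0 _ _).le ?_
    rw [rank_prod']
    simp
  exact ⟨e.toAddEquiv⟩

theorem exists_doubling_cocycle {p q n : ℕ} [Fact p.Prime] [NeZero q] (hq : q + 1 = 2 ^ p)
    (U : Type) [AddCommGroup U] [Fintype U] (hU : q ^ n ≤ Fintype.card U) :
    ∃ f : ZMod p × U → Fin n → ZMod q, f 0 = 0 ∧ Function.Surjective f ∧
      (∀ v, f (v + (1, 0)) = 2 • f v) ∧
      ∀ k, (Finset.univ.filter fun v => f v = k).card ≤
        2 * Fintype.card (ZMod p × U) / q ^ n := by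
  have htwo : (2 : ZMod q) ^ p = 1 := by
    have := congrArg (Nat.cast : ℕ → ZMod q) hq
    simpa using this.symm
  have hK : Fintype.card (Fin n → ZMod q) = q ^ n := by simp [ZMod.card]
  obtain ⟨c, hc0, hc, hcard⟩ := exists_balanced_map U (Fin n → ZMod q) (hK.trans_le hU)
  refine ⟨fun v => (2 : ZMod q) ^ v.1.val • c v.2, by simp [hc0], fun k => ?_, fun v => ?_,
    fun k => ?_⟩
  · obtain ⟨u, rfl⟩ := hc k
    exact ⟨(0, u), by simp⟩
  · have : (2 : ZMod q) ^ (v.1 + 1).val = 2 * 2 ^ v.1.val := by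
      rw [ZMod.val_add, ← pow_eq_pow_mod _ htwo, ZMod.val_one, pow_succ, mul_comm]
    simp only [Prod.fst_add, Prod.snd_add, add_zero, this, mul_smul]
    rw [two_smul, two_smul]
  · rw [Nat.le_div_iff_mul_le (pow_pos (NeZero.pos q) n), Fintype.card_prod, ZMod.card,
      Finset.card_filter, ← Finset.univ_product_univ, Finset.sum_product, Finset.sum_mul]
    have hs : ∀ s : ZMod p, (∑ u : U, if (2 : ZMod q) ^ s.val • c u = k then 1 else 0) * q ^ n ≤
        2 * Fintype.card U := by
      intro s
      rw [← Finset.card_filter, ← hK]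
      refine le_trans (Nat.mul_le_mul_right _ ?_) (hcard ((2 : ZMod q) ^ (p - s.val) • k))
      refine Finset.card_le_card fun u hu => ?_
      simp only [Finset.mem_filter, Finset.mem_univ, true_and] at hu ⊢
      rw [← hu, smul_smul, ← pow_add, Nat.sub_add_cancel (ZMod.val_lt s).le, htwo, one_smul]
    refine (Finset.sum_le_sum fun s _ => hs s).trans_eq ?_
    simp [ZMod.card]
    ring

theorem cIP_three_le_of_solutionFree {p q n : ℕ} [Fact p.Prime] [NeZero q] (hq : q + 1 = 2 ^ p)
    (B : Finset (Fin n → ZMod q))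
    (hB : ∀ a w, a ∈ B → a + w ∈ B → a + 3 • w ∈ B → w = 0) :
    cIP (Fpω p) 3 (B.card / (q : ℝ) ^ n) ≤ B.card / (q : ℝ) ^ n * (2 / (q : ℝ) ^ n) := by
  obtain ⟨L, hL⟩ := pow_unbounded_of_one_lt (q ^ n) (Fact.out : p.Prime).one_lt
  have hU : q ^ n ≤ Fintype.card (Fin L → ZMod p) := by simpa [ZMod.card] using hL.le
  obtain ⟨e⟩ := nonempty_addEquiv_finsupp p (Fin L → ZMod p)
  obtain ⟨f, hf0, hf, hft, hfM⟩ := exists_doubling_cocycle hq (Fin L → ZMod p) hU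
  have h := cIP_le_of_cocycle hf0 hf hft (fun k => by convert hfM k) B hB
  have hq0 : (0 : ℝ) < q := by exact_mod_cast NeZero.pos q
  have hV : (0 : ℝ) < Fintype.card (ZMod p × (Fin L → ZMod p)) := by
    exact_mod_cast Fintype.card_pos
  have hK : (Fintype.card (Fin n → ZMod q) : ℝ) = (q : ℝ) ^ n := by simp [ZMod.card]
  rw [cIP_congr e, ← hK]
  refine h.trans (mul_le_mul_of_nonneg_left ?_ (by positivity))
  rw [div_le_iff₀ hV]
  refine Nat.cast_div_le.trans_eq ?_
  rw [hK]
  push_cast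
  ring

theorem three_rpow_logb_two_lt {p q : ℕ} (hp : 2 < p) (hp4 : p ≠ 4) (hq : q + 1 = 2 ^ p) :
    (3 : ℝ) ^ Real.logb 2 p < q := by
  have hpq : p ^ 8 < q ^ 5 := by
    obtain rfl | hp5 : p = 3 ∨ 5 ≤ p := by omega
    · obtain rfl : q = 7 := by omega
      norm_num
    · have hsq : p ^ 2 < q := by
        have : p ^ 2 + 1 < 2 ^ p := by
          clear hq hp4 hp
          induction p, hp5 using Nat.le_induction with
          | base => norm_num
          | succ m hm ih =>
            rw [pow_succ 2 m]
            nlinarith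
        omega
      calc p ^ 8 ≤ p ^ 10 := Nat.pow_le_pow_right (by omega) (by norm_num)
        _ = (p ^ 2) ^ 5 := by ring
        _ < q ^ 5 := Nat.pow_lt_pow_left hsq (by norm_num)
  have hp0 : (0 : ℝ) < p := by positivity
  have hq0 : (0 : ℝ) < q := by
    have : 0 < q := Nat.pos_of_ne_zero (by rintro rfl; simp at hpq)
    exact_mod_cast this
  have hlog2 : 0 < Real.log 2 := Real.log_pos (by norm_num)
  have hlogp : 0 < Real.log p := Real.log_pos (by exact_mod_cast (by omega : 1 < p))
  have h1 : 5 * Real.log 3 ≤ 8 * Real.log 2 := by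
    have := Real.log_le_log (by norm_num) (by norm_num : (3 : ℝ) ^ 5 ≤ 2 ^ 8)
    simpa [Real.log_pow] using this
  have h2 : 8 * Real.log p < 5 * Real.log q := by
    have := Real.log_lt_log (by positivity) (by exact_mod_cast hpq : (p : ℝ) ^ 8 < (q : ℝ) ^ 5)
    simpa [Real.log_pow] using this
  rw [Real.rpow_def_of_pos (by norm_num), ← Real.lt_log_iff_exp_lt hq0, Real.logb,
    ← mul_div_assoc, div_lt_iff₀ hlog2]
  nlinarith

theorem eventually_two_div_pow_le {l q : ℝ} (hq : 1 ≤ q) (h : (3 : ℝ) ^ l < q) :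
    ∀ᶠ n : ℕ in atTop, 2 / q ^ n ≤ ((1 / 3) ^ n / (n * q ^ 2 + 1)) ^ l := by
  obtain ⟨k, hk⟩ := exists_nat_ge l
  have hq0 : 0 < q := by linarith
  have h3 : (0 : ℝ) < 3 ^ l := by positivity
  have hlim := (tendsto_pow_const_mul_const_pow_of_abs_lt_one k (r := 3 ^ l / q) (by
    rw [abs_of_nonneg (by positivity), div_lt_one hq0]
    exact h)).const_mul (2 * (2 * q ^ 2) ^ k)
  rw [mul_zero] at hlim
  filter_upwards [hlim.eventually (eventually_le_nhds one_pos), eventually_ge_atTop 1]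
    with n hn hn1
  have hn1' : (1 : ℝ) ≤ n := by exact_mod_cast hn1
  have hT1 : (1 : ℝ) ≤ n * q ^ 2 + 1 := by
    nlinarith [mul_pos (by linarith : (0 : ℝ) < n) (pow_pos hq0 2)]
  have hT : (n * q ^ 2 + 1 : ℝ) ^ l ≤ (2 * q ^ 2) ^ k * n ^ k := by
    calc (n * q ^ 2 + 1 : ℝ) ^ l ≤ (n * q ^ 2 + 1 : ℝ) ^ (k : ℝ) :=
          Real.rpow_le_rpow_of_exponent_le hT1 hk
      _ = (n * q ^ 2 + 1) ^ k := Real.rpow_natCast _ _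
      _ ≤ (2 * q ^ 2 * n) ^ k := by
          gcongr
          nlinarith [one_le_pow₀ hq (n := 2)]
      _ = _ := mul_pow _ _ _
  have hpow : ((3 : ℝ) ^ n) ^ l = (3 ^ l) ^ n := by
    rw [← Real.rpow_natCast, ← Real.rpow_natCast, ← Real.rpow_mul (by norm_num),
      ← Real.rpow_mul (by norm_num), mul_comm]
  rw [one_div, inv_pow, inv_eq_one_div, div_div, Real.div_rpow one_pos.le (by positivity),
    Real.one_rpow, Real.mul_rpow (by positivity) (by positivity), hpow,
    div_le_div_iff₀ (by positivity) (by positivity), one_mul]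
  rw [div_pow, ← mul_div_assoc, ← mul_div_assoc, div_le_one (by positivity)] at hn
  calc 2 * ((3 ^ l) ^ n * (n * q ^ 2 + 1 : ℝ) ^ l)
      ≤ 2 * ((3 ^ l) ^ n * ((2 * q ^ 2) ^ k * n ^ k)) := by gcongr
    _ = 2 * (2 * q ^ 2) ^ k * (n ^ k * (3 ^ l) ^ n) := by ring
    _ ≤ q ^ n := hn

/-- **Strong upper bound for the Furstenberg–Katznelson IP Roth constant over finite
fields**: for every prime `p > 2` there are arbitrarily small `δ ∈ (0,1]` with
`c_IP(3, δ, F_p^ω) ≤ δ^(1 + log₂ p) + δ^(2 log₂ p)`. -/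
theorem fk_ip_roth_strong_upper_bound (p : ℕ) (hp : p.Prime) (hp2 : 2 < p) :
    ∀ δ₀ : ℝ, 0 < δ₀ → ∃ δ : ℝ, 0 < δ ∧ δ ≤ δ₀ ∧ δ ≤ 1 ∧
      cIP (Fpω p) 3 δ ≤
        δ ^ ((1 : ℝ) + Real.logb 2 p) + δ ^ (2 * Real.logb 2 p) := by
  intro δ₀ hδ₀
  have : Fact p.Prime := ⟨hp⟩
  have h8 : 2 ^ 3 ≤ 2 ^ p := Nat.pow_le_pow_right (by norm_num) hp2
  obtain ⟨q, hq⟩ : ∃ q, q + 1 = 2 ^ p := ⟨2 ^ p - 1, by omega⟩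
  have hq7 : 7 ≤ q := by omega
  have : NeZero q := ⟨by omega⟩
  have hp4 : p ≠ 4 := by
    rintro rfl
    exact absurd hp (by norm_num)
  set D := (q + 2) / 3 with hD
  have hl : 0 ≤ Real.logb 2 p :=
    Real.logb_nonneg (by norm_num) (by exact_mod_cast hp.one_lt.le)
  have hqR : (7 : ℝ) ≤ q := by exact_mod_cast hq7
  have hq0 : (0 : ℝ) < q := by linarith
  have hsmall := (tendsto_pow_atTop_nhds_zero_of_lt_one (r := (1 / 2 : ℝ)) (by norm_num)
    (by norm_num)).eventually (eventually_le_nhds hδ₀)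
  obtain ⟨n, hn, hnδ⟩ := ((eventually_two_div_pow_le (by linarith)
    (three_rpow_logb_two_lt hp2 hp4 hq)).and hsmall).exists
  obtain ⟨B, hB, hBlow, hBup⟩ :=
    exists_solutionFree (q := q) (D := D) n (by omega) (by omega)
  have hlow : (1 / 3 : ℝ) ^ n / (n * q ^ 2 + 1) ≤ B.card / (q : ℝ) ^ n := by
    have hDq : (q : ℝ) / 3 ≤ D := by
      have : q ≤ 3 * D := by omega
      have : (q : ℝ) ≤ 3 * D := by exact_mod_cast this
      linarith
    rw [le_div_iff₀ (by positivity)]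
    refine le_trans ?_ hBlow
    push_cast
    rw [div_mul_eq_mul_div, ← mul_pow]
    gcongr
    linarith
  have hup : (B.card / (q : ℝ) ^ n) ≤ (1 / 2) ^ n := by
    have hDq : (D : ℝ) ≤ 1 / 2 * q := by
      have : 2 * D ≤ q := by omega
      have : (2 * D : ℝ) ≤ q := by exact_mod_cast this
      linarith
    rw [div_le_iff₀ (by positivity), ← mul_pow]
    calc (B.card : ℝ) ≤ (D : ℝ) ^ n := by exact_mod_cast hBup
      _ ≤ _ := by gcongr
  have hpos : 0 < B.card / (q : ℝ) ^ n := lt_of_lt_of_le (by positivity) hlow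
  refine ⟨B.card / (q : ℝ) ^ n, hpos, hup.trans hnδ,
    hup.trans (pow_le_one₀ (by norm_num) (by norm_num)), ?_⟩
  refine (cIP_three_le_of_solutionFree hq B hB).trans (le_add_of_le_of_nonneg ?_ (by positivity))
  rw [Real.rpow_add hpos, Real.rpow_one]
  refine mul_le_mul_of_nonneg_left (hn.trans ?_) hpos.le
  exact Real.rpow_le_rpow (by positivity) hlow hl

end
end
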